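/- Let θ > 0, σ > 0 and δ > 0. On a probability space, let Y₀ be Gaussian with law N(0, σ²/(2θ)) and G standard Gaussian N(0, 1), independent of each other. For t > 0 define m(t) := e^{−tδ}·Y₀ and v(t) := σ²·(1 − e^{−2tδ})/(2t), set Y₁ := m(θ) + √(v(θ))·G, and define L(t) := −(1/2)·log(2π·v(t)) − (Y₁ − m(t))²/(2·v(t)). Then the derivative L′(θ) (with respect to t, at t = θ, with Y₀ and Y₁ held fixed) satisfies E[(L′(θ))²] = δ²·e^{−2θδ}/(1 − e^{−2θδ}) + (1/2)·( 2δ·e^{−2θδ}/(1 − e^{−2θδ}) − 1/θ )². -/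

import Mathlib

open MeasureTheory ProbabilityTheory

/-- All monomials are integrable with respect to a real Gaussian law. -/
lemma integrable_pow_gaussianReal (μ : ℝ) (v : NNReal) (n : ℕ) :
    Integrable (fun x : ℝ => x ^ n) (gaussianReal μ v) :=
  integrable_pow_of_mem_interior_integrableExpSet (X := fun x : ℝ => x) (by simp) n

/-- The second moment of a centered real Gaussian law is its variance. -/
lemma integral_sq_gaussianReal (v : NNReal) : ∫ x, x ^ 2 ∂gaussianReal 0 v = v := by
  have h := variance_fun_id_gaussianReal (μ := 0) (v := v)
  rw [variance_eq_integral measurable_id'.aemeasurable] at h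
  simpa using h

/-- The fourth moment of a centered real Gaussian law with variance `v` is `3 * v ^ 2`. -/
lemma integral_pow_four_gaussianReal (v : NNReal) :
    ∫ x, x ^ 4 ∂gaussianReal 0 v = 3 * (v : ℝ) ^ 2 := by
  have hmgf : ∫ x, x ^ 4 ∂gaussianReal 0 v
      = iteratedDeriv 4 (mgf (fun x ↦ x) (gaussianReal 0 v)) 0 := by
    rw [iteratedDeriv_mgf_zero] <;> simp
  have hE (t : ℝ) : HasDerivAt (fun t : ℝ => Real.exp (v * t ^ 2 / 2))
      (v * t * Real.exp (v * t ^ 2 / 2)) t := by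
    convert! (((hasDerivAt_pow 2 t).const_mul (v : ℝ)).div_const 2).exp using 1
    push_cast
    ring
  have h₁ : deriv (fun t : ℝ => Real.exp (v * t ^ 2 / 2))
      = fun t => v * t * Real.exp (v * t ^ 2 / 2) := funext fun t => (hE t).deriv
  have h₂ : deriv (fun t : ℝ => v * t * Real.exp (v * t ^ 2 / 2))
      = fun t => (v + v ^ 2 * t ^ 2) * Real.exp (v * t ^ 2 / 2) := by
    ext t
    rw [(((hasDerivAt_id' t).const_mul (v : ℝ)).fun_mul (hE t)).deriv]
    ring
  have h₃ : deriv (fun t : ℝ => (v + v ^ 2 * t ^ 2) * Real.exp (v * t ^ 2 / 2))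
      = fun t => (3 * v ^ 2 * t + v ^ 3 * t ^ 3) * Real.exp (v * t ^ 2 / 2) := by
    ext t
    rw [((((hasDerivAt_pow 2 t).const_mul ((v : ℝ) ^ 2)).const_add (v : ℝ)).fun_mul (hE t)).deriv]
    push_cast
    ring
  have h₄ : deriv (fun t : ℝ => (3 * v ^ 2 * t + v ^ 3 * t ^ 3) * Real.exp (v * t ^ 2 / 2)) 0
      = 3 * (v : ℝ) ^ 2 := by
    rw [((((hasDerivAt_id' (0 : ℝ)).const_mul (3 * (v : ℝ) ^ 2)).fun_add
      ((hasDerivAt_pow 3 (0 : ℝ)).const_mul ((v : ℝ) ^ 3))).fun_mul (hE 0)).deriv]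
    simp
  rw [hmgf, mgf_fun_id_gaussianReal]
  simp only [iteratedDeriv_succ, iteratedDeriv_zero, zero_mul, zero_add]
  rw [h₁, h₂, h₃, h₄]

/-- Second moment of `a * (Z ^ 2 - 1) + b * (X * Z)` for independent centered Gaussian variables
`X` of variance `s` and `Z` of variance one. -/
lemma integral_sq_score_of_indepFun {Ω : Type*} [MeasurableSpace Ω] {P : Measure Ω}
    [IsProbabilityMeasure P] {X Z : Ω → ℝ} (hX : Measurable X) (hZ : Measurable Z) {s : NNReal}
    (hXlaw : P.map X = gaussianReal 0 s) (hZlaw : P.map Z = gaussianReal 0 1)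
    (hXZ : IndepFun X Z P) (a b : ℝ) :
    ∫ ω, (a * (Z ω ^ 2 - 1) + b * (X ω * Z ω)) ^ 2 ∂P = 2 * a ^ 2 + b ^ 2 * s := by
  have iX (n : ℕ) : Integrable (fun ω => X ω ^ n) P :=
    (hXlaw ▸ integrable_pow_gaussianReal 0 s n : Integrable _ (P.map X)).comp_measurable hX
  have iZ (n : ℕ) : Integrable (fun ω => Z ω ^ n) P :=
    (hZlaw ▸ integrable_pow_gaussianReal 0 1 n : Integrable _ (P.map Z)).comp_measurable hZ
  have iXZ (k n : ℕ) : Integrable (fun ω => X ω ^ k * Z ω ^ n) P :=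
    (hXZ.comp (measurable_id.pow_const k) (measurable_id.pow_const n)).integrable_mul
      (iX k) (iZ n)
  have eX (n : ℕ) : ∫ ω, X ω ^ n ∂P = ∫ x, x ^ n ∂gaussianReal 0 s := by
    rw [← hXlaw, integral_map hX.aemeasurable (by fun_prop)]
  have eZ (n : ℕ) : ∫ ω, Z ω ^ n ∂P = ∫ x, x ^ n ∂gaussianReal 0 1 := by
    rw [← hZlaw, integral_map hZ.aemeasurable (by fun_prop)]
  have eXZ (k n : ℕ) : ∫ ω, X ω ^ k * Z ω ^ n ∂P
      = (∫ x, x ^ k ∂gaussianReal 0 s) * ∫ x, x ^ n ∂gaussianReal 0 1 := by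
    rw [← eX, ← eZ]
    exact hXZ.integral_fun_comp_mul_comp hX.aemeasurable hZ.aemeasurable
      (f := fun x => x ^ k) (g := fun x => x ^ n) (by fun_prop) (by fun_prop)
  have hexp (ω : Ω) : (a * (Z ω ^ 2 - 1) + b * (X ω * Z ω)) ^ 2
      = a ^ 2 * Z ω ^ 4 + (-2 * a ^ 2) * Z ω ^ 2 + a ^ 2 + b ^ 2 * (X ω ^ 2 * Z ω ^ 2)
        + 2 * a * b * (X ω ^ 1 * Z ω ^ 3) + (-2 * a * b) * (X ω ^ 1 * Z ω ^ 1) := by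
    ring
  simp_rw [hexp]
  have i₁ := (iZ 4).const_mul (a ^ 2)
  have i₂ := (iZ 2).const_mul (-2 * a ^ 2)
  have i₃ : Integrable (fun _ : Ω => a ^ 2) P := integrable_const _
  have i₄ := (iXZ 2 2).const_mul (b ^ 2)
  have i₅ := (iXZ 1 3).const_mul (2 * a * b)
  have i₆ := (iXZ 1 1).const_mul (-2 * a * b)
  rw [integral_add ((((i₁.fun_add i₂).fun_add i₃).fun_add i₄).fun_add i₅) i₆,
    integral_add (((i₁.fun_add i₂).fun_add i₃).fun_add i₄) i₅,
    integral_add ((i₁.fun_add i₂).fun_add i₃) i₄,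
    integral_add (i₁.fun_add i₂) i₃, integral_add i₁ i₂]
  simp only [integral_const_mul, eZ, eXZ]
  simp only [integral_sq_gaussianReal, integral_pow_four_gaussianReal, pow_one,
    integral_id_gaussianReal, integral_const, probReal_univ, NNReal.coe_one, smul_eq_mul]
  ring

/-- Derivative of a Gaussian log-likelihood along a curve of means and variances. -/
lemma hasDerivAt_gaussian_logLikelihood {m v : ℝ → ℝ} {m' v' t : ℝ} (y : ℝ)
    (hm : HasDerivAt m m' t) (hv : HasDerivAt v v' t) (hpos : 0 < v t) :
    HasDerivAt (fun t => -(1 / 2) * Real.log (2 * Real.pi * v t) - (y - m t) ^ 2 / (2 * v t))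
      (-(v' / (2 * v t)) + (y - m t) * m' / v t + (y - m t) ^ 2 * v' / (2 * v t ^ 2)) t := by
  have hπ := Real.pi_pos
  convert! (((hv.const_mul (2 * Real.pi)).log (by positivity)).const_mul (-(1 / 2))).sub
    (((hm.const_sub y).fun_pow 2).fun_div (hv.const_mul 2) (by positivity)) using 1
  field_simp
  push_cast
  ring

/-- Derivative in the drift of the Ornstein–Uhlenbeck transition variance. -/
lemma hasDerivAt_ou_variance {t : ℝ} (σ δ : ℝ) (ht : t ≠ 0) :
    HasDerivAt (fun t => σ ^ 2 * (1 - Real.exp (-2 * t * δ)) / (2 * t))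
      (σ ^ 2 * (2 * δ * Real.exp (-2 * t * δ)) / (2 * t)
        - σ ^ 2 * (1 - Real.exp (-2 * t * δ)) / (2 * t ^ 2)) t := by
  convert! ((((((hasDerivAt_id' t).const_mul (-2)).mul_const δ).exp.const_sub 1).const_mul
    (σ ^ 2)).fun_div ((hasDerivAt_id' t).const_mul 2) (by positivity)) using 1
  field_simp

/-- Fisher information for the drift parameter of the Ornstein–Uhlenbeck process
(Section 4.3 / Table 1): with `Y₀ ~ N(0, σ²/(2θ))`, `G ~ N(0,1)` independent,
`m(t) = e^{−tδ}Y₀`, `v(t) = σ²(1−e^{−2tδ})/(2t)`, `Y₁ = m(θ) + √(v(θ))·G` and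
`L(t)` the Gaussian transition log-likelihood, the score satisfies
`E[(L′(θ))²] = δ²e^{−2θδ}/(1−e^{−2θδ}) + (1/2)(2δe^{−2θδ}/(1−e^{−2θδ}) − 1/θ)²`. -/
theorem ou_fisher_information_drift
    {Ω : Type*} [MeasurableSpace Ω] (P : Measure Ω) [IsProbabilityMeasure P]
    (θ σ δ : ℝ) (hθ : 0 < θ) (hσ : 0 < σ) (hδ : 0 < δ)
    (Y₀ G : Ω → ℝ)
    (hY₀meas : Measurable Y₀) (hGmeas : Measurable G)
    (hY₀law : P.map Y₀ = gaussianReal 0 ((σ ^ 2 / (2 * θ)).toNNReal))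
    (hGlaw : P.map G = gaussianReal 0 1)
    (hindep : IndepFun Y₀ G P)
    (m : ℝ → Ω → ℝ) (hm : ∀ t ω, m t ω = Real.exp (-t * δ) * Y₀ ω)
    (v : ℝ → ℝ) (hv : ∀ t, 0 < t → v t = σ ^ 2 * (1 - Real.exp (-2 * t * δ)) / (2 * t))
    (Y₁ : Ω → ℝ) (hY₁ : ∀ ω, Y₁ ω = m θ ω + Real.sqrt (v θ) * G ω)
    (L : ℝ → Ω → ℝ)
    (hL : ∀ t ω, 0 < t → L t ω = -(1 / 2) * Real.log (2 * Real.pi * v t) -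
      (Y₁ ω - m t ω) ^ 2 / (2 * v t)) :
    (∫ ω, (deriv (fun t => L t ω) θ) ^ 2 ∂P) =
      δ ^ 2 * Real.exp (-2 * θ * δ) / (1 - Real.exp (-2 * θ * δ)) +
        1 / 2 * (2 * δ * Real.exp (-2 * θ * δ) / (1 - Real.exp (-2 * θ * δ)) - 1 / θ) ^ 2 := by
  have hE1 : Real.exp (-2 * θ * δ) < 1 := Real.exp_lt_one_iff.mpr (by nlinarith [mul_pos hθ hδ])
  have hsq : Real.exp (-θ * δ) ^ 2 = Real.exp (-2 * θ * δ) := by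
    rw [← Real.exp_nat_mul]
    congr 1
    push_cast
    ring
  have hvθ := hv θ hθ
  have hvpos : 0 < v θ := by
    rw [hvθ]
    have := sub_pos.mpr hE1
    positivity
  have hnear : ∀ᶠ t in nhds θ, 0 < t := lt_mem_nhds hθ
  have hvd := (hasDerivAt_ou_variance σ δ hθ.ne').congr_of_eventuallyEq
    (hnear.mono fun t ht => hv t ht)
  have hscore (ω : Ω) : deriv (fun t => L t ω) θ
      = (δ * Real.exp (-2 * θ * δ) / (1 - Real.exp (-2 * θ * δ)) - 1 / (2 * θ)) * (G ω ^ 2 - 1)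
        + -(δ * Real.exp (-θ * δ)) / Real.sqrt (v θ) * (Y₀ ω * G ω) := by
    have hmd : HasDerivAt (fun t => m t ω) (-(δ * Real.exp (-θ * δ)) * Y₀ ω) θ := by
      simp_rw [hm]
      convert! (((hasDerivAt_id' θ).fun_neg.mul_const δ).exp.mul_const (Y₀ ω)) using 1
      ring
    rw [((hasDerivAt_gaussian_logLikelihood (Y₁ ω) hmd hvd hvpos).congr_of_eventuallyEq
      (hnear.mono fun t ht => hL t ω ht)).deriv]
    have hres : Y₁ ω - m θ ω = Real.sqrt (v θ) * G ω := by rw [hY₁]; ring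
    have hs : Real.sqrt (v θ) ^ 2 = v θ := Real.sq_sqrt hvpos.le
    have hspos := Real.sqrt_pos.mpr hvpos
    have hmean : Real.sqrt (v θ) * G ω * (-(δ * Real.exp (-θ * δ)) * Y₀ ω) / v θ
        = -(δ * Real.exp (-θ * δ)) / Real.sqrt (v θ) * (Y₀ ω * G ω) := by
      nth_rw 2 [← hs]
      field_simp
    have hne := (sub_pos.mpr hE1).ne'
    rw [hres, hmean, mul_pow, hs]
    generalize -(δ * Real.exp (-θ * δ)) / Real.sqrt (v θ) * (Y₀ ω * G ω) = c
    rw [hvθ]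
    generalize Real.exp (-2 * θ * δ) = e at hne ⊢
    field_simp
    ring
  simp_rw [hscore]
  rw [integral_sq_score_of_indepFun hY₀meas hGmeas hY₀law hGlaw hindep, div_pow,
    Real.sq_sqrt hvpos.le, neg_sq, mul_pow, hsq, Real.coe_toNNReal _ (by positivity), hvθ]
  have hne := (sub_pos.mpr hE1).ne'
  generalize Real.exp (-2 * θ * δ) = e at hne ⊢
  field_simp
  ring
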